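/- No WMPL sentence can express the a-acceptance property, even over finitely-branching Kripke trees. Moreover, WMPL ≡ FO, MPL ≡ CoWMPL, and WMPL < MPL, all of these holding even over the class of finitely-branching Kripke trees. -/

import Mathlib

/-! ## Trees over ℕ* -/

abbrev Node : Type := List ℕ

/-- `T` is a tree with root `r`: `r ∈ T`, every node extends `r`, and `T` is
prefix-closed above `r`. -/
def IsTreeRooted (T : Set Node) (r : Node) : Prop :=
  r ∈ T ∧ (∀ τ ∈ T, r <+: τ) ∧
    ∀ σ σ' : List ℕ, r ++ σ ∈ T → σ' <+: σ → r ++ σ' ∈ T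

/-- `T ⊆ ℕ*` is a tree. -/
def IsTree (T : Set Node) : Prop := ∃ r : Node, IsTreeRooted T r

/-- `τ'` is a child of `τ` in `T`. -/
def childIn (T : Set Node) (τ τ' : Node) : Prop := τ' ∈ T ∧ ∃ n : ℕ, τ' = τ ++ [n]

/-- every node of `T` has a child in `T`. -/
def NonBlocking (T : Set Node) : Prop := ∀ τ ∈ T, ∃ n : ℕ, τ ++ [n] ∈ T

/-- every node of `T` has finitely many children in `T`. -/
def FinBranching (T : Set Node) : Prop := ∀ τ ∈ T, {τ' : Node | childIn T τ τ'}.Finite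

/-- `S` is a subtree of `T`. -/
def IsSubtree (T S : Set Node) : Prop := S ⊆ T ∧ IsTree S

/-- `P` is a path of `T`: a subtree totally ordered by the child relation
(each node has at most one child in `P`). -/
def IsPathOf (T P : Set Node) : Prop :=
  IsSubtree T P ∧ ∀ τ ∈ P, ∀ n m : ℕ, τ ++ [n] ∈ P → τ ++ [m] ∈ P → n = m

/-- `T` is a chain: a tree in which each node has at most one child. -/
def IsChainTree (T : Set Node) : Prop :=
  IsTree T ∧ ∀ τ ∈ T, ∀ n m : ℕ, τ ++ [n] ∈ T → τ ++ [m] ∈ T → n = m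

/-- `T` is dense: it contains a subtree every node of which has a descendant
in the subtree with at least two distinct children in the subtree. -/
def DenseTree (T : Set Node) : Prop :=
  ∃ S : Set Node, IsSubtree T S ∧ ∀ τ ∈ S, ∃ τ' ∈ S, τ <+: τ' ∧
    ∃ n m : ℕ, n ≠ m ∧ τ' ++ [n] ∈ S ∧ τ' ++ [m] ∈ S

/-- A Kripke tree over `AP`: a non-blocking tree together with a labelling. -/
structure KripkeTree (AP : Type) where
  T : Set Node
  root : Node
  rooted : IsTreeRooted T root
  nonblocking : NonBlocking T
  Lab : Node → Set AP

/-! ## MSOL syntax -/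

inductive MSOL (AP : Type) : Type
  | atom : AP → ℕ → MSOL AP          -- P_a(x)
  | le   : ℕ → ℕ → MSOL AP           -- x ≤ y
  | mem  : ℕ → ℕ → MSOL AP           -- x ∈ X
  | not  : MSOL AP → MSOL AP
  | and  : MSOL AP → MSOL AP → MSOL AP
  | exFO : ℕ → MSOL AP → MSOL AP     -- ∃x. φ
  | exSO : ℕ → MSOL AP → MSOL AP     -- ∃X. φ

namespace MSOL

def freeFO {AP : Type} : MSOL AP → Set ℕ
  | atom _ x => {x}
  | le x y => {x, y}
  | mem x _ => {x}
  | not φ => φ.freeFO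
  | and φ ψ => φ.freeFO ∪ ψ.freeFO
  | exFO x φ => φ.freeFO \ {x}
  | exSO _ φ => φ.freeFO

def freeSO {AP : Type} : MSOL AP → Set ℕ
  | atom _ _ => ∅
  | le _ _ => ∅
  | mem _ X => {X}
  | not φ => φ.freeSO
  | and φ ψ => φ.freeSO ∪ ψ.freeSO
  | exFO _ φ => φ.freeSO
  | exSO X φ => φ.freeSO \ {X}

/-- A sentence is a formula with no free variables. -/
def IsSentence {AP : Type} (φ : MSOL AP) : Prop := φ.freeFO = ∅ ∧ φ.freeSO = ∅

/-- The first-order fragment: no second-order variables. -/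
def IsFO {AP : Type} : MSOL AP → Prop
  | atom _ _ => True
  | le _ _ => True
  | mem _ _ => False
  | not φ => φ.IsFO
  | and φ ψ => φ.IsFO ∧ ψ.IsFO
  | exFO _ φ => φ.IsFO
  | exSO _ _ => False

end MSOL

/-! ## MSOL semantics, parametrized by the range of second-order quantifiers -/

/-- A second-order domain: for each tree, the collection of sets that
second-order quantifiers range over. -/
abbrev SODom : Type := Set Node → Set (Set Node)

def Sat {AP : Type} (D : SODom) (K : KripkeTree AP) :
    (ℕ → Node) → (ℕ → Set Node) → MSOL AP → Prop
  | V1, _,  .atom a x => V1 x ∈ K.T ∧ a ∈ K.Lab (V1 x)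
  | V1, _,  .le x y => V1 x ∈ K.T ∧ V1 y ∈ K.T ∧ V1 x <+: V1 y
  | V1, V2, .mem x X => V1 x ∈ V2 X
  | V1, V2, .not φ => ¬ Sat D K V1 V2 φ
  | V1, V2, .and φ ψ => Sat D K V1 V2 φ ∧ Sat D K V1 V2 ψ
  | V1, V2, .exFO x φ => ∃ τ ∈ K.T, Sat D K (Function.update V1 x τ) V2 φ
  | V1, V2, .exSO X φ => ∃ S ∈ D K.T, Sat D K V1 (Function.update V2 X S) φ

/-- A logic: a syntactic fragment of MSOL together with a second-order domain. -/
structure MLogic (AP : Type) where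
  syn : MSOL AP → Prop
  dom : SODom

namespace MLogic

/-- A Kripke tree satisfies a sentence. -/
def KSat {AP : Type} (L : MLogic AP) (K : KripkeTree AP) (φ : MSOL AP) : Prop :=
  ∃ V1 V2, Sat L.dom K V1 V2 φ

/-- `L ≤ L'` over the class `M`. -/
def Leq {AP : Type} (M : Set (KripkeTree AP)) (L L' : MLogic AP) : Prop :=
  ∀ φ : MSOL AP, φ.IsSentence → L.syn φ →
    ∃ φ' : MSOL AP, φ'.IsSentence ∧ L'.syn φ' ∧
      ∀ K ∈ M, (L.KSat K φ ↔ L'.KSat K φ')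

/-- `L < L'` over the class `M`. -/
def Lt {AP : Type} (M : Set (KripkeTree AP)) (L L' : MLogic AP) : Prop :=
  Leq M L L' ∧ ¬ Leq M L' L

/-- `L ≡ L'` over the class `M`. -/
def EquivExp {AP : Type} (M : Set (KripkeTree AP)) (L L' : MLogic AP) : Prop :=
  Leq M L L' ∧ Leq M L' L

/-- `L` and `L'` are expressively incomparable over the class `M`. -/
def Incomp {AP : Type} (M : Set (KripkeTree AP)) (L L' : MLogic AP) : Prop :=
  ¬ Leq M L L' ∧ ¬ Leq M L' L

end MLogic

/-! ## The concrete logics -/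

def MSOdom : SODom := fun T => {S | S ⊆ T}
def MTLdom : SODom := fun T => {S | S ⊆ T ∧ IsTree S}
def MPLdom : SODom := fun T => {S | IsPathOf T S}
def weakDom (D : SODom) : SODom := fun T => {S | S ∈ D T ∧ S.Finite}
def coweakDom (D : SODom) : SODom := fun T => {S | S ∈ D T ∧ S.Infinite}

def MSO (AP : Type) : MLogic AP := ⟨fun _ => True, MSOdom⟩
def MTL (AP : Type) : MLogic AP := ⟨fun _ => True, MTLdom⟩
def MPL (AP : Type) : MLogic AP := ⟨fun _ => True, MPLdom⟩
def WMSO (AP : Type) : MLogic AP := ⟨fun _ => True, weakDom MSOdom⟩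
def WMTL (AP : Type) : MLogic AP := ⟨fun _ => True, weakDom MTLdom⟩
def WMPL (AP : Type) : MLogic AP := ⟨fun _ => True, weakDom MPLdom⟩
def CoWMSO (AP : Type) : MLogic AP := ⟨fun _ => True, coweakDom MSOdom⟩
def CoWMTL (AP : Type) : MLogic AP := ⟨fun _ => True, coweakDom MTLdom⟩
def CoWMPL (AP : Type) : MLogic AP := ⟨fun _ => True, coweakDom MPLdom⟩
def FOL (AP : Type) : MLogic AP := ⟨MSOL.IsFO, MSOdom⟩

/-! ## Classes of Kripke trees -/

def allKT (AP : Type) : Set (KripkeTree AP) := Set.univ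
def finBrKT (AP : Type) : Set (KripkeTree AP) := {K | FinBranching K.T}
/-- Kripke trees whose underlying tree is an infinite chain
(every node has exactly one child). -/
def chainKT (AP : Type) : Set (KripkeTree AP) :=
  {K | ∀ τ ∈ K.T, ∃! τ' : Node, childIn K.T τ τ'}

/-- `(T, Lab)` satisfies the `a`-acceptance property: every infinite path of
`T` starting at the root visits some node labelled by `a`. -/
def aAccept {AP : Type} (a : AP) (K : KripkeTree AP) : Prop :=
  ∀ P : Set Node, IsPathOf K.T P → P.Infinite → K.root ∈ P →
    ∃ τ ∈ P, a ∈ K.Lab τ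

/-! ## Syntax lemmas -/

section PartA
variable {AP : Type}

theorem sat_congr (D : SODom) (K : KripkeTree AP) (φ : MSOL AP) :
    ∀ (V1 V1' : ℕ → Node) (V2 V2' : ℕ → Set Node),
    (∀ x ∈ φ.freeFO, V1 x = V1' x) → (∀ X ∈ φ.freeSO, V2 X = V2' X) →
    (Sat D K V1 V2 φ ↔ Sat D K V1' V2' φ) := by
  induction φ with
  | atom a x => intro V1 V1' V2 V2' h1 h2; simp [Sat, h1 x (by simp [MSOL.freeFO])]
  | le x y =>
    intro V1 V1' V2 V2' h1 h2
    simp [Sat, h1 x (by simp [MSOL.freeFO]), h1 y (by simp [MSOL.freeFO])]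
  | mem x X =>
    intro V1 V1' V2 V2' h1 h2
    simp [Sat, h1 x (by simp [MSOL.freeFO]), h2 X (by simp [MSOL.freeSO])]
  | not φ ih => intro V1 V1' V2 V2' h1 h2; exact not_congr (ih _ _ _ _ h1 h2)
  | and φ ψ ih1 ih2 =>
    intro V1 V1' V2 V2' h1 h2
    exact and_congr (ih1 _ _ _ _ (fun x hx => h1 x (Or.inl hx)) (fun x hx => h2 x (Or.inl hx)))
      (ih2 _ _ _ _ (fun x hx => h1 x (Or.inr hx)) (fun x hx => h2 x (Or.inr hx)))
  | exFO x φ ih =>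
    intro V1 V1' V2 V2' h1 h2
    refine exists_congr fun τ => and_congr_right fun _ => ih _ _ _ _ ?_ h2
    intro z hz
    by_cases h : z = x
    · subst h; simp
    · simp [Function.update_of_ne h]; exact h1 z ⟨hz, h⟩
  | exSO X φ ih =>
    intro V1 V1' V2 V2' h1 h2
    refine exists_congr fun τ => and_congr_right fun _ => ih _ _ _ _ h1 ?_
    intro z hz
    by_cases h : z = X
    · subst h; simp
    · simp [Function.update_of_ne h]; exact h2 z ⟨hz, h⟩

theorem ksat_iff (L : MLogic AP) (K : KripkeTree AP) (φ : MSOL AP) (h : φ.IsSentence)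
    (V1 : ℕ → Node) (V2 : ℕ → Set Node) : L.KSat K φ ↔ Sat L.dom K V1 V2 φ := by
  constructor
  · rintro ⟨W1, W2, hW⟩
    exact (sat_congr _ K φ _ _ _ _ (by simp [h.1]) (by simp [h.2])).1 hW
  · intro hW; exact ⟨V1, V2, hW⟩

theorem sat_FO (D D' : SODom) (K : KripkeTree AP) (φ : MSOL AP) :
    φ.IsFO → ∀ (V1 : ℕ → Node) (V2 : ℕ → Set Node), (Sat D K V1 V2 φ ↔ Sat D' K V1 V2 φ) := by
  induction φ with
  | atom a x => intro _ V1 V2; simp [Sat]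
  | le x y => intro _ V1 V2; simp [Sat]
  | mem x X => intro h; exact h.elim
  | not φ ih => intro h V1 V2; exact not_congr (ih h V1 V2)
  | and φ ψ ih1 ih2 => intro h V1 V2; exact and_congr (ih1 h.1 V1 V2) (ih2 h.2 V1 V2)
  | exFO x φ ih =>
    intro h V1 V2; exact exists_congr fun τ => and_congr_right fun _ => ih h _ _
  | exSO X φ ih => intro h; exact h.elim

theorem leq_of_FO (M : Set (KripkeTree AP)) (L : MLogic AP) (hL : ∀ φ, L.syn φ) :
    MLogic.Leq M (FOL AP) L := by
  intro φ hs hφ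
  refine ⟨φ, hs, hL φ, fun K _ => ?_⟩
  exact exists_congr fun V1 => exists_congr fun V2 => sat_FO _ _ K φ hφ V1 V2

theorem leq_trans' {M : Set (KripkeTree AP)} {L1 L2 L3 : MLogic AP}
    (h : MLogic.Leq M L1 L2) (h' : MLogic.Leq M L2 L3) : MLogic.Leq M L1 L3 := by
  intro φ hs hφ
  obtain ⟨ψ, a, b, c⟩ := h φ hs hφ
  obtain ⟨χ, a', b', c'⟩ := h' ψ a b
  exact ⟨χ, a', b', fun K hK => (c K hK).trans (c' K hK)⟩

/-! ## Paths -/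

theorem tree_down {T : Set Node} {r u v z : Node} (h : IsTreeRooted T r) (hu : u ∈ T) (hv : v ∈ T)
    (huz : u <+: z) (hzv : z <+: v) : z ∈ T := by
  have h1 := (h.2.1 u hu).trans huz
  obtain ⟨s, rfl⟩ := h1
  obtain ⟨w, rfl⟩ := hzv
  exact h.2.2 (s ++ w) s (by simpa using hv) (List.prefix_append _ _)

theorem path_cmp {T S : Set Node} (hS : IsPathOf T S) {x y : Node} (hx : x ∈ S) (hy : y ∈ S)
    (hl : x.length ≤ y.length) : x <+: y := by
  obtain ⟨⟨hsub, r, hr⟩, huniq⟩ := hS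
  obtain ⟨s, rfl⟩ := hr.2.1 x hx
  obtain ⟨w, rfl⟩ := hr.2.1 y hy
  simp at hl
  have key : ∀ n, n ≤ s.length → s.take n = w.take n := by
    intro n
    induction n with
    | zero => simp
    | succ n ih =>
      intro hn
      have e := ih (by omega)
      have h1 : s.take (n+1) = s.take n ++ [s[n]] := by
        rw [List.take_add_one, List.getElem?_eq_getElem (by omega)]; rfl
      have h2 : w.take (n+1) = w.take n ++ [w[n]] := by
        rw [List.take_add_one, List.getElem?_eq_getElem (by omega)]; rfl
      have m0 := hr.2.2 s (s.take n) hx (List.take_prefix _ _)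
      have m1 := hr.2.2 s (s.take (n+1)) hx (List.take_prefix _ _)
      have m2 := hr.2.2 w (w.take (n+1)) hy (List.take_prefix _ _)
      rw [h1] at m1
      rw [h2, ← e] at m2
      rw [← List.append_assoc] at m1 m2
      have := huniq _ m0 _ _ m1 m2
      rw [h1, h2, e, this]
  have := key s.length le_rfl
  simp at this
  rw [List.prefix_append_right_inj, this]
  exact List.take_prefix _ _

theorem finite_prefixes (v : Node) : {z : Node | z <+: v}.Finite := by
  apply (List.finite_toSet v.inits).subset
  intro z hz
  simpa using hz

theorem finpath_iff (K : KripkeTree AP) (S : Set Node) :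
    (IsPathOf K.T S ∧ S.Finite) ↔
      ∃ u ∈ K.T, ∃ v ∈ K.T, u <+: v ∧ S = {z | z ∈ K.T ∧ u <+: z ∧ z <+: v} := by
  constructor
  · rintro ⟨hS, hfin⟩
    obtain ⟨⟨hsub, r, hr⟩, huniq⟩ := id hS
    obtain ⟨v, hv, hmax⟩ := Set.exists_max_image S List.length hfin ⟨r, hr.1⟩
    refine ⟨r, hsub hr.1, v, hsub hv, hr.2.1 v hv, ?_⟩
    ext z
    constructor
    · intro hz
      exact ⟨hsub hz, hr.2.1 z hz, path_cmp hS hz hv (hmax z hz)⟩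
    · rintro ⟨_, h1, h2⟩
      exact tree_down hr hr.1 hv h1 h2
  · rintro ⟨u, hu, v, hv, huv, rfl⟩
    refine ⟨⟨⟨fun z hz => hz.1, u, ⟨hu, List.prefix_rfl, huv⟩, fun z hz => hz.2.1, ?_⟩, ?_⟩, ?_⟩
    · intro s s' hs hp
      have h1 : u ++ s' <+: v := ((List.prefix_append_right_inj u).2 hp).trans hs.2.2
      exact ⟨tree_down K.rooted hu hv (List.prefix_append _ _) h1, List.prefix_append _ _, h1⟩
    · intro τ _ n m hn hm
      have := (List.prefix_of_prefix_length_le hn.2.2 hm.2.2 (by simp)).eq_of_length (by simp)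
      simpa using this
    · exact (finite_prefixes v).subset fun z hz => hz.2.2

theorem infpath_iff (K : KripkeTree AP) (S : Set Node) (hS : IsPathOf K.T S) :
    S.Infinite ↔ ∀ τ ∈ S, ∃ σ ∈ S, ¬ σ <+: τ := by
  constructor
  · intro h τ hτ
    by_contra hc
    push Not at hc
    exact h ((finite_prefixes τ).subset hc)
  · intro h hf
    obtain ⟨u, hu, v, hv, huv, rfl⟩ := (finpath_iff K S).1 ⟨hS, hf⟩
    obtain ⟨s, hs, hn⟩ := h v ⟨hv, huv, List.prefix_rfl⟩
    exact hn hs.2.2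

/-! ## Translation of finite paths to pairs of nodes -/

def trF (b : Bool) : (ℕ → Bool) → MSOL AP → MSOL AP
  | _, .atom a x => .atom a (3*x)
  | _, .le x y => .le (3*x) (3*y)
  | F, .mem x X => if F X then .mem (3*x) X else .and (.le (3*X+1) (3*x)) (.le (3*x) (3*X+2))
  | F, .not φ => .not (trF b F φ)
  | F, .and φ ψ => .and (trF b F φ) (trF b F ψ)
  | F, .exFO x φ => .exFO (3*x) (trF b F φ)
  | F, .exSO X φ =>
    let f : MSOL AP := .exFO (3*X+1) (.exFO (3*X+2)
      (.and (.le (3*X+1) (3*X+2)) (trF b (Function.update F X false) φ)))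
    if b then .not (.and (.not f) (.not (.exSO X (trF b (Function.update F X true) φ)))) else f

theorem trF_FO (φ : MSOL AP) : ∀ F : ℕ → Bool, (∀ X, F X = false) → (trF false F φ).IsFO := by
  induction φ with
  | atom a x => intro F h; simp [trF, MSOL.IsFO]
  | le x y => intro F h; simp [trF, MSOL.IsFO]
  | mem x X => intro F h; simp [trF, MSOL.IsFO, h]
  | not φ ih => intro F h; exact ih F h
  | and φ ψ ih1 ih2 => intro F h; exact ⟨ih1 F h, ih2 F h⟩
  | exFO x φ ih => intro F h; exact ih F h
  | exSO X φ ih =>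
    intro F h
    simp only [trF, MSOL.IsFO]
    refine ⟨trivial, ih _ ?_⟩
    intro Y
    by_cases hY : Y = X
    · subst hY; simp
    · simp [Function.update_of_ne hY, h]

theorem trF_freeFO (b : Bool) (φ : MSOL AP) : ∀ F : ℕ → Bool, ∀ z ∈ (trF b F φ).freeFO,
    (∃ x ∈ φ.freeFO, z = 3*x) ∨ (∃ X ∈ φ.freeSO, F X = false ∧ (z = 3*X+1 ∨ z = 3*X+2)) := by
  induction φ with
  | atom a x => intro F z; simp [trF, MSOL.freeFO, MSOL.freeSO]
  | le x y => intro F z; simp [trF, MSOL.freeFO, MSOL.freeSO]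
  | mem x X =>
    intro F z
    by_cases h : F X = true
    · simp [trF, MSOL.freeFO, h]; grind
    · simp [trF, MSOL.freeFO, MSOL.freeSO, h]; grind
  | not φ ih => intro F; exact ih F
  | and φ ψ ih1 ih2 =>
    intro F z hz
    rcases hz with hz | hz
    · rcases ih1 F z hz with ⟨x, hx, h⟩ | ⟨x, hx, h⟩
      · exact Or.inl ⟨x, Or.inl hx, h⟩
      · exact Or.inr ⟨x, Or.inl hx, h⟩
    · rcases ih2 F z hz with ⟨x, hx, h⟩ | ⟨x, hx, h⟩
      · exact Or.inl ⟨x, Or.inr hx, h⟩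
      · exact Or.inr ⟨x, Or.inr hx, h⟩
  | exFO x φ ih =>
    intro F z hz
    rcases ih F z hz.1 with ⟨y, hy, h⟩ | h
    · refine Or.inl ⟨y, ⟨hy, ?_⟩, h⟩
      rintro rfl; exact hz.2 h
    · exact Or.inr h
  | exSO X φ ih =>
    intro F z hz
    have key : (z ∈ (trF b (Function.update F X false) φ).freeFO ∧ z ≠ 3*X+1 ∧ z ≠ 3*X+2) ∨
        z ∈ (trF b (Function.update F X true) φ).freeFO := by
      cases b <;> simp [trF, MSOL.freeFO] at hz <;> grind
    rcases key with ⟨h, h1, h2⟩ | h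
    · rcases ih _ z h with h | ⟨Y, hY, hF, h⟩
      · exact Or.inl h
      · have : Y ≠ X := by rintro rfl; omega
        rw [Function.update_of_ne this] at hF
        exact Or.inr ⟨Y, ⟨hY, this⟩, hF, h⟩
    · rcases ih _ z h with h | ⟨Y, hY, hF, h⟩
      · exact Or.inl h
      · have : Y ≠ X := by rintro rfl; simp at hF
        rw [Function.update_of_ne this] at hF
        exact Or.inr ⟨Y, ⟨hY, this⟩, hF, h⟩

theorem trF_freeSO (b : Bool) (φ : MSOL AP) : ∀ F : ℕ → Bool, ∀ Z ∈ (trF b F φ).freeSO,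
    Z ∈ φ.freeSO ∧ F Z = true := by
  induction φ with
  | atom a x => intro F z; simp [trF, MSOL.freeSO]
  | le x y => intro F z; simp [trF, MSOL.freeSO]
  | mem x X =>
    intro F z
    by_cases h : F X = true
    · simp [trF, MSOL.freeSO, h]; grind
    · simp [trF, MSOL.freeSO, h]
  | not φ ih => intro F; exact ih F
  | and φ ψ ih1 ih2 =>
    intro F z hz
    rcases hz with hz | hz
    · exact ⟨Or.inl (ih1 F z hz).1, (ih1 F z hz).2⟩
    · exact ⟨Or.inr (ih2 F z hz).1, (ih2 F z hz).2⟩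
  | exFO x φ ih => intro F; exact ih F
  | exSO X φ ih =>
    intro F z hz
    have key : z ∈ (trF b (Function.update F X false) φ).freeSO ∨
        (z ∈ (trF b (Function.update F X true) φ).freeSO ∧ z ≠ X) := by
      cases b <;> simp [trF, MSOL.freeSO] at hz <;> grind
    rcases key with h | ⟨h, h1⟩
    · obtain ⟨h2, h3⟩ := ih _ z h
      have : z ≠ X := by rintro rfl; simp at h3
      rw [Function.update_of_ne this] at h3
      exact ⟨⟨h2, this⟩, h3⟩
    · obtain ⟨h2, h3⟩ := ih _ z h
      rw [Function.update_of_ne h1] at h3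
      exact ⟨⟨h2, h1⟩, h3⟩

theorem trF_sentence (b : Bool) (φ : MSOL AP) (h : φ.IsSentence) (F : ℕ → Bool) :
    (trF b F φ).IsSentence := by
  constructor
  · ext z
    simp only [Set.mem_empty_iff_false, iff_false]
    intro hz
    have := trF_freeFO b φ F z hz
    simp [h.1, h.2] at this
  · ext z
    simp only [Set.mem_empty_iff_false, iff_false]
    intro hz
    have := trF_freeSO b φ F z hz
    simp [h.2] at this

def TrInv (K : KripkeTree AP) (F : ℕ → Bool) (V1 W1 : ℕ → Node) (V2 W2 : ℕ → Set Node) : Prop :=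
  (∀ x, V1 x = W1 (3*x)) ∧ (∀ X, F X = true → V2 X = W2 X) ∧
  (∀ X, F X = false → W1 (3*X+1) ∈ K.T ∧ W1 (3*X+2) ∈ K.T ∧
    V2 X = {z | z ∈ K.T ∧ W1 (3*X+1) <+: z ∧ z <+: W1 (3*X+2)})

theorem trF_sat (b : Bool) (D D' : SODom) (K : KripkeTree AP)
    (hD : ∀ S, S ∈ D K.T ↔ (IsPathOf K.T S ∧ S.Finite) ∨ (b = true ∧ S ∈ D' K.T))
    (φ : MSOL AP) : ∀ F V1 W1 V2 W2, TrInv K F V1 W1 V2 W2 →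
      (Sat D K V1 V2 φ ↔ Sat D' K W1 W2 (trF b F φ)) := by
  induction φ with
  | atom a x => intro F V1 W1 V2 W2 h; simp [trF, Sat, h.1]
  | le x y => intro F V1 W1 V2 W2 h; simp [trF, Sat, h.1]
  | mem x X =>
    intro F V1 W1 V2 W2 h
    cases hF : F X with
    | true => simp [trF, Sat, hF, h.1, h.2.1 X hF]
    | false =>
      obtain ⟨h1, h2, h3⟩ := h.2.2 X hF
      simp [trF, Sat, hF, h.1, h1, h2, h3]
  | not φ ih => intro F V1 W1 V2 W2 h; exact not_congr (ih _ _ _ _ _ h)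
  | and φ ψ ih1 ih2 =>
    intro F V1 W1 V2 W2 h; exact and_congr (ih1 _ _ _ _ _ h) (ih2 _ _ _ _ _ h)
  | exFO x φ ih =>
    intro F V1 W1 V2 W2 h
    refine exists_congr fun τ => and_congr_right fun _ => ih _ _ _ _ _ ⟨?_, h.2.1, ?_⟩
    · intro y
      by_cases hy : y = x
      · subst hy; simp
      · rw [Function.update_of_ne hy, Function.update_of_ne (by omega), h.1]
    · intro X hX
      rw [Function.update_of_ne (by omega), Function.update_of_ne (by omega)]
      exact h.2.2 X hX
  | exSO X φ ih =>
    intro F V1 W1 V2 W2 h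
    have hfin : (∃ S, (IsPathOf K.T S ∧ S.Finite) ∧ Sat D K V1 (Function.update V2 X S) φ) ↔
        Sat D' K W1 W2 (.exFO (3*X+1) (.exFO (3*X+2)
      (.and (.le (3*X+1) (3*X+2)) (trF b (Function.update F X false) φ)))) := by
      have hinv : ∀ u ∈ K.T, ∀ v ∈ K.T, TrInv K (Function.update F X false) V1
          (Function.update (Function.update W1 (3*X+1) u) (3*X+2) v)
          (Function.update V2 X {z | z ∈ K.T ∧ u <+: z ∧ z <+: v}) W2 := by
        intro u hu v hv
        refine ⟨?_, ?_, ?_⟩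
        · intro x
          rw [Function.update_of_ne (by omega), Function.update_of_ne (by omega), h.1]
        · intro Y hY
          have : Y ≠ X := by rintro rfl; simp at hY
          rw [Function.update_of_ne this] at hY ⊢
          exact h.2.1 Y hY
        · intro Y hY
          by_cases hYX : Y = X
          · subst hYX
            simp [hu, hv]
          · rw [Function.update_of_ne hYX] at hY ⊢
            rw [Function.update_of_ne (by omega), Function.update_of_ne (by omega),
              Function.update_of_ne (by omega), Function.update_of_ne (by omega)]
            exact h.2.2 Y hY
      simp only [Sat]
      constructor
      · rintro ⟨S, hS, hsat⟩
        obtain ⟨u, hu, v, hv, huv, rfl⟩ := (finpath_iff K S).1 hS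
        refine ⟨u, hu, v, hv, ?_, (ih _ _ _ _ _ (hinv u hu v hv)).1 hsat⟩
        simp [hu, hv, huv]
      · rintro ⟨u, hu, v, hv, h1, h2⟩
        simp [hu, hv] at h1
        exact ⟨_, (finpath_iff K _).2 ⟨u, hu, v, hv, h1, rfl⟩,
          (ih _ _ _ _ _ (hinv u hu v hv)).2 h2⟩
    have hinf : (∃ S, S ∈ D' K.T ∧ Sat D K V1 (Function.update V2 X S) φ) ↔
        Sat D' K W1 W2 (.exSO X (trF b (Function.update F X true) φ)) := by
      refine exists_congr fun S => and_congr_right fun _ => ih _ _ _ _ _ ⟨h.1, ?_, ?_⟩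
      · intro Y hY
        by_cases hYX : Y = X
        · subst hYX; simp
        · rw [Function.update_of_ne hYX] at hY ⊢
          rw [Function.update_of_ne hYX]
          exact h.2.1 Y hY
      · intro Y hY
        have : Y ≠ X := by rintro rfl; simp at hY
        rw [Function.update_of_ne this] at hY ⊢
        exact h.2.2 Y hY
    have hsplit : Sat D K V1 V2 (.exSO X φ) ↔
        (∃ S, (IsPathOf K.T S ∧ S.Finite) ∧ Sat D K V1 (Function.update V2 X S) φ) ∨
        (b = true ∧ ∃ S, S ∈ D' K.T ∧ Sat D K V1 (Function.update V2 X S) φ) := by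
      constructor
      · rintro ⟨S, hS, hs⟩
        rcases (hD S).1 hS with h | ⟨h1, h⟩
        · exact Or.inl ⟨S, h, hs⟩
        · exact Or.inr ⟨h1, S, h, hs⟩
      · rintro (⟨S, h, hs⟩ | ⟨h1, S, h, hs⟩)
        · exact ⟨S, (hD S).2 (Or.inl h), hs⟩
        · exact ⟨S, (hD S).2 (Or.inr ⟨h1, h⟩), hs⟩
    rw [hsplit, hfin, hinf]
    cases b with
    | false => simp [trF]
    | true =>
      simp only [trF, if_true, true_and]
      generalize (MSOL.exSO X (trF true (Function.update F X true) φ)) = A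
      generalize (MSOL.exFO (3*X+1) _) = B
      simp only [Sat]
      tauto

theorem leq_trF (b : Bool) (M : Set (KripkeTree AP)) (L L' : MLogic AP)
    (hs : ∀ φ : MSOL AP, L'.syn (trF b (fun _ => false) φ))
    (hD : ∀ (K : KripkeTree AP) (S : Set Node), S ∈ L.dom K.T ↔
      (IsPathOf K.T S ∧ S.Finite) ∨ (b = true ∧ S ∈ L'.dom K.T)) : MLogic.Leq M L L' := by
  intro φ hφ _
  refine ⟨trF b (fun _ => false) φ, trF_sentence b φ hφ _, hs φ, fun K _ => ?_⟩
  rw [ksat_iff L K φ hφ (fun _ => K.root)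
      (fun _ => {z | z ∈ K.T ∧ K.root <+: z ∧ z <+: K.root}),
    ksat_iff L' K _ (trF_sentence b φ hφ _) (fun _ => K.root) (fun _ => ∅)]
  exact trF_sat b _ _ K (hD K) φ _ _ _ _ _
    ⟨fun _ => rfl, by simp, fun _ _ => ⟨K.rooted.1, K.rooted.1, rfl⟩⟩

theorem wmpl_leq_fo (M : Set (KripkeTree AP)) : MLogic.Leq M (WMPL AP) (FOL AP) := by
  apply leq_trF false
  · intro φ; exact trF_FO φ _ (fun _ => rfl)
  · intro K S; simp [WMPL, weakDom, MPLdom]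

theorem mpl_leq_cowmpl (M : Set (KripkeTree AP)) : MLogic.Leq M (MPL AP) (CoWMPL AP) := by
  apply leq_trF true
  · intro φ; trivial
  · intro K S
    simp only [MPL, CoWMPL, coweakDom, MPLdom, Set.mem_ofPred_eq, true_and, Set.Infinite]
    tauto

/-! ## CoWMPL to MPL -/

def infF (X : ℕ) : MSOL AP :=
  .not (.exFO 0 (.and (.mem 0 X) (.not (.exFO 1 (.and (.mem 1 X) (.not (.le 1 0)))))))

theorem infF_sat (D : SODom) (K : KripkeTree AP) (V1 : ℕ → Node) (V2 : ℕ → Set Node) (X : ℕ)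
    (hS : IsPathOf K.T (V2 X)) : Sat D K V1 V2 (infF X) ↔ (V2 X).Infinite := by
  rw [infpath_iff K _ hS]
  have hsub := hS.1.1
  simp only [infF, Sat]
  simp
  constructor
  · intro h τ hτ
    obtain ⟨s, h1, h2, h3⟩ := h τ (hsub hτ) hτ
    exact ⟨s, h2, h3 h1 (hsub hτ)⟩
  · intro h τ hT hτ
    obtain ⟨s, h1, h2⟩ := h τ hτ
    exact ⟨s, hsub h1, h1, fun _ _ => h2⟩

def trC : MSOL AP → MSOL AP
  | .atom a x => .atom a x
  | .le x y => .le x y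
  | .mem x X => .mem x X
  | .not φ => .not (trC φ)
  | .and φ ψ => .and (trC φ) (trC ψ)
  | .exFO x φ => .exFO x (trC φ)
  | .exSO X φ => .exSO X (.and (infF X) (trC φ))

theorem trC_free (φ : MSOL AP) :
    (trC φ).freeFO = φ.freeFO ∧ (trC φ).freeSO = φ.freeSO := by
  induction φ with
  | atom a x => simp [trC]
  | le x y => simp [trC]
  | mem x X => simp [trC]
  | not φ ih => exact ih
  | and φ ψ ih1 ih2 => simp [trC, MSOL.freeFO, MSOL.freeSO, ih1, ih2]
  | exFO x φ ih => simp [trC, MSOL.freeFO, MSOL.freeSO, ih]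
  | exSO X φ ih =>
    simp only [trC, infF, MSOL.freeFO, MSOL.freeSO, ih]
    constructor
    · ext z; simp
    · ext z; simp

theorem trC_sat (K : KripkeTree AP) (φ : MSOL AP) : ∀ V1 V2,
    (Sat (coweakDom MPLdom) K V1 V2 φ ↔ Sat MPLdom K V1 V2 (trC φ)) := by
  induction φ with
  | atom a x => intro V1 V2; simp [trC, Sat]
  | le x y => intro V1 V2; simp [trC, Sat]
  | mem x X => intro V1 V2; simp [trC, Sat]
  | not φ ih => intro V1 V2; exact not_congr (ih _ _)
  | and φ ψ ih1 ih2 => intro V1 V2; exact and_congr (ih1 _ _) (ih2 _ _)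
  | exFO x φ ih =>
    intro V1 V2; exact exists_congr fun τ => and_congr_right fun _ => ih _ _
  | exSO X φ ih =>
    intro V1 V2
    simp only [trC, Sat, coweakDom, Set.mem_ofPred_eq, and_assoc]
    refine exists_congr fun S => and_congr_right fun hS => ?_
    rw [infF_sat _ _ _ _ _ (by simpa [MPLdom] using hS), ← ih]
    simp

theorem cowmpl_leq_mpl (M : Set (KripkeTree AP)) : MLogic.Leq M (CoWMPL AP) (MPL AP) := by
  intro φ hφ _
  refine ⟨trC φ, ⟨(trC_free φ).1.trans hφ.1, (trC_free φ).2.trans hφ.2⟩, trivial, fun K _ => ?_⟩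
  exact exists_congr fun V1 => exists_congr fun V2 => trC_sat K φ V1 V2

/-! ## Acceptance in MPL -/

def accF (a : AP) : MSOL AP :=
  .not (.exSO 0 (.and (infF 0) (.and
    (.exFO 0 (.and (.mem 0 0) (.not (.exFO 1 (.not (.le 0 1))))))
    (.not (.exFO 0 (.and (.mem 0 0) (.atom a 0)))))))

theorem accF_sentence (a : AP) : (accF a).IsSentence := by
  constructor
  · simp only [accF, infF, MSOL.freeFO]
    ext z; simp
  · simp only [accF, infF, MSOL.freeSO]
    ext z; simp

theorem accF_sat (a : AP) (K : KripkeTree AP) : (MPL AP).KSat K (accF a) ↔ aAccept a K := by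
  rw [ksat_iff _ K _ (accF_sentence a) (fun _ => K.root) (fun _ => ∅)]
  have hroot : ∀ S : Set Node, S ⊆ K.T →
      ((∃ τ ∈ K.T, τ ∈ S ∧ ∀ σ ∈ K.T, τ ∈ K.T ∧ σ ∈ K.T ∧ τ <+: σ) ↔ K.root ∈ S) := by
    intro S hS
    constructor
    · rintro ⟨τ, h1, h2, h3⟩
      have := (h3 _ K.rooted.1).2.2
      have h4 := K.rooted.2.1 τ h1
      have := this.eq_of_length_le h4.length_le
      exact this ▸ h2
    · intro h
      exact ⟨_, K.rooted.1, h, fun s hs => ⟨K.rooted.1, hs, K.rooted.2.1 s hs⟩⟩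
  have key : ∀ S : Set Node, IsPathOf K.T S → (Sat MPLdom K (fun _ => K.root)
      (Function.update (fun _ => ∅) 0 S) (.and (infF 0) (.and
    (.exFO 0 (.and (.mem 0 0) (.not (.exFO 1 (.not (.le 0 1))))))
    (.not (.exFO 0 (.and (.mem 0 0) (.atom a 0)))))) ↔
      S.Infinite ∧ K.root ∈ S ∧ ¬ ∃ τ ∈ S, a ∈ K.Lab τ) := by
    intro S hS
    show Sat _ _ _ _ (infF 0) ∧ _ ↔ _
    rw [infF_sat _ _ _ _ _ (by simpa using hS), ← hroot S hS.1.1]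
    have := hS.1.1
    simp [Sat]
    grind
  show ¬ (∃ S, IsPathOf K.T S ∧ _) ↔ _
  unfold aAccept
  constructor
  · intro h P h1 h2 h3
    by_contra hc
    exact h ⟨P, h1, (key P h1).2 ⟨h2, h3, hc⟩⟩
  · rintro h ⟨P, h1, h2⟩
    obtain ⟨h3, h4, h5⟩ := (key P h1).1 h2
    exact h5 (h P h1 h3 h4)

end PartA

/-! ## The Ehrenfeucht-Fraisse argument -/

section PartB

def BT : Set Node := {τ | ∀ i ∈ τ, i < 2}

structure HT (M : ℤ) (H : Node → ℤ) : Prop where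
  mono : ∀ x i, H (x ++ [i]) ≤ H x
  step : ∀ x i, H x - 1 ≤ H (x ++ [i])
  exact : ∀ x i, H x ≤ M → H (x ++ [i]) = H x - 1
  one : ∀ x, H (x ++ [1]) ≤ M

theorem HT.append {M : ℤ} {H : Node → ℤ} (h : HT M H) (x w : Node) :
    H (x ++ w) ≤ H x ∧ H x - w.length ≤ H (x ++ w) ∧
      (H x ≤ M → H (x ++ w) = H x - w.length) := by
  induction w using List.reverseRecOn with
  | nil => simp
  | append_singleton w i ih =>
    have h1 := h.mono (x ++ w) i
    have h2 := h.step (x ++ w) i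
    have h3 := h.exact (x ++ w) i
    rw [← List.append_assoc]
    simp only [List.length_append, List.length_singleton]
    push_cast
    obtain ⟨a, b, c⟩ := ih
    refine ⟨by omega, by omega, fun hx => ?_⟩
    have := c hx
    have := h3 (by omega)
    omega

theorem HT.pre {M : ℤ} {H : Node → ℤ} (h : HT M H) {x v : Node} (hx : x <+: v) :
    H v ≤ H x ∧ H x - (v.length - x.length : ℤ) ≤ H v ∧
      (H x ≤ M → H v = H x - (v.length - x.length : ℤ)) ∧ (x.length : ℤ) ≤ v.length := by
  obtain ⟨w, rfl⟩ := hx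
  have := h.append x w
  simp only [List.length_append]
  push_cast
  refine ⟨this.1, by omega, fun hM => by have := this.2.2 hM; omega, by omega⟩

theorem HT.ivt {M : ℤ} {H : Node → ℤ} (h : HT M H) (u w : Node) (c : ℤ)
    (h1 : H (u ++ w) ≤ c) (h2 : c ≤ H u) : ∃ y, u <+: y ∧ y <+: u ++ w ∧ H y = c := by
  induction w using List.reverseRecOn with
  | nil => simp at h1; exact ⟨u, by simp, by simp, by omega⟩
  | append_singleton w i ih =>
    by_cases hc : H (u ++ w) ≤ c
    · obtain ⟨y, a, b, d⟩ := ih hc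
      refine ⟨y, a, b.trans ?_, d⟩
      rw [← List.append_assoc]; exact List.prefix_append _ _
    · refine ⟨u ++ (w ++ [i]), List.prefix_append _ _, List.prefix_rfl, ?_⟩
      have := h.step (u ++ w) i
      rw [← List.append_assoc] at h1 ⊢
      omega

def EqT (t a b : ℤ) : Prop := a = b ∨ (t ≤ a ∧ t ≤ b) ∨ (a ≤ -t ∧ b ≤ -t)

def IsMeet (p x y : Node) : Prop := ∀ s : Node, s <+: p ↔ s <+: x ∧ s <+: y

theorem node_between {u v : Node} (h : u <+: v) (d : ℤ) (h0 : 0 ≤ d)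
    (h1 : d ≤ v.length - u.length) : ∃ y, u <+: y ∧ y <+: v ∧ (y.length : ℤ) = u.length + d := by
  obtain ⟨w, rfl⟩ := h
  simp at h1
  refine ⟨u ++ w.take d.toNat, List.prefix_append _ _,
    (List.prefix_append_right_inj u).2 (List.take_prefix _ _), ?_⟩
  simp; omega

theorem pick_edge {M t : ℤ} {H H' : Node → ℤ} (ht : 1 ≤ t) (htM : 4 * t ≤ M)
    (h : HT M H) (h' : HT M H') {u x v u' v' : Node} (hux : u <+: x) (hxv : x <+: v)
    (hne : u ≠ x) (hne' : x ≠ v)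
    (huv' : u' <+: v') (hD : EqT (4*t) (v.length - u.length) (v'.length - u'.length))
    (hu : EqT (4*t) (H u) (H' u')) (hv : EqT (4*t) (H v) (H' v')) :
    ∃ y, u' <+: y ∧ y <+: v' ∧ EqT t (x.length - u.length) (y.length - u'.length) ∧
      EqT t (v.length - x.length) (v'.length - y.length) ∧ EqT t (H x) (H' y) := by
  have a1 := h.pre hux
  have a2 := h.pre hxv
  have a3 := h'.pre huv'
  have l1 : u.length ≠ x.length := fun e => hne (hux.eq_of_length e)
  have l2 : x.length ≠ v.length := fun e => hne' (hxv.eq_of_length e)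
  have build : ∀ d : ℤ, 0 ≤ d → d ≤ v'.length - u'.length →
      (∀ hy : ℤ, (H' v' ≤ hy) → hy ≤ H' u' → H' u' - d ≤ hy →
        (H' u' ≤ M → hy = H' u' - d) →
        hy - (v'.length - u'.length - d) ≤ H' v' →
        (hy ≤ M → H' v' = hy - (v'.length - u'.length - d)) →
        EqT t (x.length - u.length) d ∧
        EqT t (v.length - x.length) (v'.length - u'.length - d) ∧ EqT t (H x) hy) →
      ∃ y, u' <+: y ∧ y <+: v' ∧ EqT t (x.length - u.length) (y.length - u'.length) ∧
      EqT t (v.length - x.length) (v'.length - y.length) ∧ EqT t (H x) (H' y) := by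
    intro d hd0 hd1 hd
    obtain ⟨y, h1, h2, h3⟩ := node_between huv' d hd0 hd1
    have b1 := h'.pre h1
    have b2 := h'.pre h2
    have e1 : (y.length : ℤ) - u'.length = d := by omega
    have e2 : (v'.length : ℤ) - y.length = v'.length - u'.length - d := by omega
    refine ⟨y, h1, h2, ?_⟩
    rw [e1, e2]
    rw [e1] at b1
    rw [e2] at b2
    exact hd (H' y) b2.1 b1.1 b1.2.1 b1.2.2.1 b2.2.1 b2.2.2.1
  obtain ⟨a11, a12, a13, a14⟩ := a1
  obtain ⟨a21, a22, a23, a24⟩ := a2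
  obtain ⟨a31, a32, a33, a34⟩ := a3
  generalize hxl : (x.length : ℤ) = xl at *
  generalize hul : (u.length : ℤ) = ul at *
  generalize hvl : (v.length : ℤ) = vl at *
  generalize hul' : (u'.length : ℤ) = ul' at *
  generalize hvl' : (v'.length : ℤ) = vl' at *
  have l3 : ul < xl := by omega
  have l4 : xl < vl := by omega
  clear l1 l2
  unfold EqT at *
  by_cases c1 : t ≤ H x
  · by_cases c2 : vl - ul < 4*t
    · exact build (xl - ul) (by omega) (by omega) (by intros; omega)
    · by_cases c3 : xl - ul < t
      · exact build (xl - ul) (by omega) (by omega) (by intros; omega)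
      · by_cases c4 : vl - xl < t
        · exact build (vl' - ul' - (vl - xl)) (by omega) (by omega) (by intros; omega)
        · exact build t (by omega) (by omega) (by intros; omega)
  by_cases c0 : H x ≤ -t
  · by_cases c2 : vl - ul < 4*t
    · exact build (xl - ul) (by omega) (by omega) (by intros; omega)
    · by_cases c3 : xl - ul < t
      · exact build (xl - ul) (by omega) (by omega) (by intros; omega)
      · by_cases c4 : vl - xl < t
        · exact build (vl' - ul' - (vl - xl)) (by omega) (by omega) (by intros; omega)
        · exact build (vl' - ul' - t) (by omega) (by omega) (by intros; omega)
  · obtain ⟨w, hw⟩ := huv'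
    obtain ⟨y, h1, h2, h3⟩ := h'.ivt u' w (H x) (by rw [hw]; omega) (by omega)
    rw [hw] at h2
    have b1 := h'.pre h1
    have b2 := h'.pre h2
    refine ⟨y, h1, h2, ?_⟩
    generalize (y.length : ℤ) = yl at *
    rw [h3] at b1 b2
    obtain ⟨b11, b12, b13, b14⟩ := b1
    obtain ⟨b21, b22, b23, b24⟩ := b2
    have f1 := a23 (by omega)
    have f2 := b23 (by omega)
    clear build a23 b23 a33 a32 a31
    refine ⟨?_, ?_, Or.inl h3.symm⟩
    · rcases hu with hu | hu | hu
      · by_cases c : H u ≤ M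
        · have := a13 c
          have := b13 (by omega)
          left; omega
        · right; left; omega
      · right; left; omega
      · omega
    · rcases hv with hv | hv | hv
      · left; omega
      · omega
      · right; left; omega

theorem pick_branch {M t : ℤ} {H H' : Node → ℤ} (ht : 1 ≤ t) (htM : 4 * t ≤ M)
    (h : HT M H) (h' : HT M H') {p x p' : Node} (hpx : p <+: x)
    (hne : p ≠ x) (e : ℕ) (hp'e : p' ++ [e] ∈ BT)
    (hp : EqT (4*t) (H p) (H' p')) :
    ∃ y ∈ BT, p' ++ [e] <+: y ∧ EqT t (x.length - p.length) (y.length - p'.length) ∧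
      EqT t (H x) (H' y) := by
  have a1 := h.pre hpx
  have l1 : p.length ≠ x.length := fun e => hne (hpx.eq_of_length e)
  have hBT : ∀ n, p' ++ [e] ++ List.replicate n 1 ∈ BT := by
    intro n i hi
    rw [List.mem_append] at hi
    rcases hi with hi | hi
    · exact hp'e i hi
    · rw [List.mem_replicate] at hi; omega
  have build : ∀ d : ℤ, 1 ≤ d → 
      (∀ hy : ℤ, hy ≤ H' p' → H' p' - d ≤ hy →
        (H' p' ≤ M → hy = H' p' - d) →
        EqT t (x.length - p.length) d ∧ EqT t (H x) hy) →
    ∃ y ∈ BT, p' ++ [e] <+: y ∧ EqT t (x.length - p.length) (y.length - p'.length) ∧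
      EqT t (H x) (H' y) := by
    intro d hd0 hd
    have hpre : p' <+: p' ++ [e] ++ List.replicate (d-1).toNat 1 := by
      rw [List.append_assoc]; exact List.prefix_append _ _
    have b1 := h'.pre hpre
    have e1 : ((p' ++ [e] ++ List.replicate (d-1).toNat 1).length : ℤ) - p'.length = d := by
      simp; omega
    refine ⟨_, hBT (d-1).toNat, List.prefix_append _ _, ?_⟩
    rw [e1] at b1 ⊢
    exact hd _ b1.1 b1.2.1 b1.2.2.1
  obtain ⟨a11, a12, a13, a14⟩ := a1
  by_cases c1 : H p < 4*t
  · exact build (x.length - p.length) (by omega) (by unfold EqT at *; intros; omega)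
  by_cases c2 : t ≤ H x
  · by_cases c3 : (x.length - p.length : ℤ) < t
    · exact build (x.length - p.length) (by omega) (by unfold EqT at *; intros; omega)
    · exact build t (by omega) (by unfold EqT at *; intros; omega)
  · have s0 := h'.step p' e
    have s1 := h'.one (p' ++ [e])
    have s2 := (h'.append (p' ++ [e] ++ [1]) (List.replicate (M - H x).toNat 1)).2.2 s1
    have e2 : p' ++ [e] ++ [1] ++ List.replicate (M - H x).toNat 1 =
        p' ++ [e] ++ List.replicate ((M - H x).toNat + 1) 1 := by
      rw [List.append_assoc (p' ++ [e]), List.replicate_succ]; rfl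
    rw [e2] at s2
    simp only [List.length_replicate] at s2
    obtain ⟨y, h1, h2, h3⟩ := h'.ivt (p' ++ [e]) (List.replicate ((M - H x).toNat + 1) 1) (H x)
      (by omega) (by unfold EqT at *; omega)
    have b1 := h'.pre ((List.prefix_append p' [e]).trans h1)
    refine ⟨y, ?_, h1, ?_⟩
    · intro i hi
      exact hBT _ i (h2.subset hi)
    · unfold EqT at *; omega

structure Good (t : ℤ) (H H' : Node → ℤ) (R : Node → Node → Prop) : Prop where
  dom : ∀ {x y}, R x y → x ∈ BT ∧ y ∈ BT
  root : R [] []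
  meet : ∀ {x y x' y'}, R x y → R x' y' → ∃ p q, R p q ∧ IsMeet p x x' ∧ IsMeet q y y'
  le : ∀ {x y x' y'}, R x y → R x' y' → (x <+: x' ↔ y <+: y')
  dist : ∀ {x y x' y'}, R x y → R x' y' → x <+: x' →
    EqT t (x'.length - x.length) (y'.length - y.length)
  ht : ∀ {x y}, R x y → EqT t (H x) (H' y)

theorem EqT.symm {t a b : ℤ} (h : EqT t a b) : EqT t b a := by unfold EqT at *; omega

theorem EqT.weaken {t s a b : ℤ} (h : EqT t a b) (hs : s ≤ t) : EqT s a b := by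
  unfold EqT at *; omega

theorem Good.symm {t : ℤ} {H H' : Node → ℤ} {R : Node → Node → Prop} (h : Good t H H' R) :
    Good t H' H (fun x y => R y x) where
  dom := fun hr => (h.dom hr).symm
  root := h.root
  meet := fun h1 h2 => by
    obtain ⟨p, q, a, b, c⟩ := h.meet h1 h2
    exact ⟨q, p, a, c, b⟩
  le := fun h1 h2 => (h.le h1 h2).symm
  dist := fun h1 h2 h3 => (h.dist h1 h2 ((h.le h1 h2).2 h3)).symm
  ht := fun h1 => (h.ht h1).symm

theorem Good.weaken {t s : ℤ} {H H' : Node → ℤ} {R : Node → Node → Prop} (h : Good t H H' R)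
    (hs : s ≤ t) : Good s H H' R where
  dom := h.dom
  root := h.root
  meet := h.meet
  le := h.le
  dist := fun h1 h2 h3 => (h.dist h1 h2 h3).weaken hs
  ht := fun h1 => (h.ht h1).weaken hs

theorem IsMeet.symm {p x y : Node} (h : IsMeet p x y) : IsMeet p y x :=
  fun s => (h s).trans and_comm

theorem Good.extend {t : ℤ} {H H' : Node → ℤ} {R : Node → Node → Prop} (h : Good t H H' R)
    (ht : 0 ≤ t) {x y : Node} (hx : x ∈ BT) (hy : y ∈ BT) (hH : EqT t (H x) (H' y))
    (h1 : ∀ z w, R z w → (z <+: x ↔ w <+: y)) (h2 : ∀ z w, R z w → (x <+: z ↔ y <+: w))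
    (h3 : ∀ z w, R z w → z <+: x → EqT t (x.length - z.length) (y.length - w.length))
    (h4 : ∀ z w, R z w → x <+: z → EqT t (z.length - x.length) (w.length - y.length))
    (h5 : ∀ z w, R z w → ∃ p q, (R p q ∨ p = x ∧ q = y) ∧ IsMeet p x z ∧ IsMeet q y w) :
    Good t H H' (fun a b => R a b ∨ a = x ∧ b = y) where
  dom := by
    rintro a b (hr | ⟨rfl, rfl⟩)
    · exact h.dom hr
    · exact ⟨hx, hy⟩
  root := Or.inl h.root
  meet := by
    rintro a b a' b' (hr | ⟨rfl, rfl⟩) (hr' | ⟨rfl, rfl⟩)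
    · obtain ⟨p, q, c, d⟩ := h.meet hr hr'
      exact ⟨p, q, Or.inl c, d⟩
    · obtain ⟨p, q, c, d, e⟩ := h5 _ _ hr
      exact ⟨p, q, c, d.symm, e.symm⟩
    · exact h5 _ _ hr'
    · exact ⟨_, _, Or.inr ⟨rfl, rfl⟩, fun s => by simp, fun s => by simp⟩
  le := by
    rintro a b a' b' (hr | ⟨rfl, rfl⟩) (hr' | ⟨rfl, rfl⟩)
    · exact h.le hr hr'
    · exact h1 _ _ hr
    · exact h2 _ _ hr'
    · simp
  dist := by
    rintro a b a' b' (hr | ⟨rfl, rfl⟩) (hr' | ⟨rfl, rfl⟩) hp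
    · exact h.dist hr hr' hp
    · exact h3 _ _ hr hp
    · exact h4 _ _ hr' hp
    · left; simp
  ht := by
    rintro a b (hr | ⟨rfl, rfl⟩)
    · exact h.ht hr
    · exact hH

theorem exists_longest (x : Node) (P : Node → Prop) (h0 : P []) :
    ∃ u, u <+: x ∧ P u ∧ ∀ z, z <+: x → P z → z <+: u := by
  obtain ⟨u, hu, hmax⟩ := Set.exists_max_image {z : Node | z <+: x ∧ P z} List.length
    ((finite_prefixes x).subset fun z hz => hz.1) ⟨[], by simp, h0⟩
  exact ⟨u, hu.1, hu.2, fun z hz hP => List.prefix_of_prefix_length_le hz hu.1 (hmax z ⟨hz, hP⟩)⟩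

theorem exists_shortest (P : Node → Prop) (h0 : ∃ a, P a) :
    ∃ u, P u ∧ ∀ z, P z → u.length ≤ z.length := by
  obtain ⟨a, ha⟩ := h0
  have := (measure (List.length (α := ℕ))).wf.has_min {z | P z} ⟨a, ha⟩
  obtain ⟨m, hm, hmin⟩ := this
  exact ⟨m, hm, fun z hz => not_lt.1 (hmin z hz)⟩

theorem BT_pre {x y : Node} (h : x <+: y) (hy : y ∈ BT) : x ∈ BT :=
  fun i hi => hy i (h.subset hi)

theorem edge_step {M t : ℤ} {H H' : Node → ℤ} (ht : 1 ≤ t) (htM : 4 * t ≤ M)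
    (hH : HT M H) (hH' : HT M H') {R : Node → Node → Prop} (h : Good (4*t) H H' R)
    {x a b : Node} (hab : R a b) (hxa : x <+: a) :
    ∃ R' : Node → Node → Prop, Good t H H' R' ∧ (∀ z w, R z w → R' z w) ∧
      (∀ z w, R' z w → ∃ z' w', R z' w' ∧ z <+: z') ∧ ∃ y, R' x y := by
  by_cases hx : ∃ y, R x y
  · exact ⟨R, h.weaken (by omega), fun _ _ h => h, fun z w hr => ⟨z, w, hr, List.prefix_rfl⟩, hx⟩
  obtain ⟨u, hux, ⟨u', hu⟩, hul⟩ := exists_longest x (fun z => ∃ w, R z w) ⟨[], h.root⟩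
  obtain ⟨v, ⟨hxv, v', hv⟩, hvs⟩ := exists_shortest (fun z => x <+: z ∧ ∃ w, R z w) ⟨a, hxa, b, hab⟩
  have hne : u ≠ x := by rintro rfl; exact hx ⟨_, hu⟩
  have hne' : x ≠ v := by rintro rfl; exact hx ⟨_, hv⟩
  have huv := hux.trans hxv
  obtain ⟨y, huy, hyv, e1, e2, e3⟩ := pick_edge ht htM hH hH' hux hxv hne hne'
    ((h.le hu hv).1 huv) (h.dist hu hv huv) (h.ht hu) (h.ht hv)
  have l1 : u.length ≠ x.length := fun e => hne (hux.eq_of_length e)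
  have l2 : x.length ≠ v.length := fun e => hne' (hxv.eq_of_length e)
  have l3 := hux.length_le
  have l4 := hxv.length_le
  have l5 := huy.length_le
  have l6 := hyv.length_le
  have l7 : u'.length < y.length := by unfold EqT at e1; omega
  have l8 : y.length < v'.length := by unfold EqT at e2; omega
  have zu : ∀ z w, R z w → z <+: x → z <+: u := fun z w hr hz => hul z hz ⟨w, hr⟩
  have xv : ∀ z w, R z w → x <+: z → v <+: z := by
    intro z w hr hz
    obtain ⟨p, q, hpq, hp, hq⟩ := h.meet hv hr
    have hxp := (hp x).2 ⟨hxv, hz⟩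
    have hpv := (hp p).1 List.prefix_rfl
    have := hvs p ⟨hxp, q, hpq⟩
    rw [← hpv.1.eq_of_length_le this]
    exact hpv.2
  have i1 : ∀ z w, R z w → (z <+: x ↔ w <+: y) := by
    intro z w hr
    constructor
    · intro hz
      exact ((h.le hr hu).1 (zu z w hr hz)).trans huy
    · intro hw
      have hzv := (h.le hr hv).2 (hw.trans hyv)
      rcases List.prefix_or_prefix_of_prefix hzv hxv with hc | hc
      · exact hc
      · have := ((h.le hv hr).1 (xv z w hr hc)).length_le
        have := hw.length_le
        omega
  have i2 : ∀ z w, R z w → (x <+: z ↔ y <+: w) := by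
    intro z w hr
    constructor
    · intro hz
      exact hyv.trans ((h.le hv hr).1 (xv z w hr hz))
    · intro hw
      obtain ⟨p, q, hpq, hp, hq⟩ := h.meet hv hr
      have hyq := (hq y).2 ⟨hyv, hw⟩
      have hpv := (hp p).1 List.prefix_rfl
      rcases List.prefix_or_prefix_of_prefix hpv.1 hxv with hc | hc
      · have := ((h.le hpq hu).1 (zu p q hpq hc)).length_le
        have := hyq.length_le
        omega
      · exact hc.trans hpv.2
  refine ⟨_, (h.weaken (by omega)).extend (t := t) (by omega) (BT_pre hxv (h.dom hv).1)
    (BT_pre hyv (h.dom hv).2) e3 i1 i2 ?_ ?_ ?_, fun z w hr => Or.inl hr, ?_,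
    y, Or.inr ⟨rfl, rfl⟩⟩
  · intro z w hr hz
    have := h.dist hr hu (zu z w hr hz)
    have l1 := (zu z w hr hz).length_le
    have l2 := ((h.le hr hu).1 (zu z w hr hz)).length_le
    unfold EqT at *; omega
  · intro z w hr hz
    have := h.dist hv hr (xv z w hr hz)
    have l1 := (xv z w hr hz).length_le
    have l2 := ((h.le hv hr).1 (xv z w hr hz)).length_le
    unfold EqT at *; omega
  · intro z w hr
    by_cases hz : x <+: z
    · refine ⟨x, y, Or.inr ⟨rfl, rfl⟩, fun s => ?_, fun s => ?_⟩
      · exact ⟨fun hs => ⟨hs, hs.trans hz⟩, fun hs => hs.1⟩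
      · exact ⟨fun hs => ⟨hs, hs.trans ((i2 z w hr).1 hz)⟩, fun hs => hs.1⟩
    · have hw : ¬ y <+: w := fun hw => hz ((i2 z w hr).2 hw)
      obtain ⟨p, q, hpq, hp, hq⟩ := h.meet hv hr
      have hpv := (hp p).1 List.prefix_rfl
      have hqv := (hq q).1 List.prefix_rfl
      have hpx : p <+: x := by
        rcases List.prefix_or_prefix_of_prefix hpv.1 hxv with hc | hc
        · exact hc
        · exact absurd (hc.trans hpv.2) hz
      have hqy : q <+: y := (i1 p q hpq).1 hpx
      refine ⟨p, q, Or.inl hpq, fun s => ?_, fun s => ?_⟩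
      · exact ⟨fun hs => ⟨hs.trans hpx, hs.trans hpv.2⟩, fun hs => (hp s).2 ⟨hs.1.trans hxv, hs.2⟩⟩
      · exact ⟨fun hs => ⟨hs.trans hqy, hs.trans hqv.2⟩, fun hs => (hq s).2 ⟨hs.1.trans hyv, hs.2⟩⟩
  · rintro z w (hr | ⟨rfl, rfl⟩)
    · exact ⟨z, w, hr, List.prefix_rfl⟩
    · exact ⟨v, v', hv, hxv⟩

/-- If `p` is a proper prefix of `z` in `BT`, then `z` goes through one of the two children. -/
theorem child_dir {p z : Node} (h : p <+: z) (hne : p ≠ z) : ∃ e, p ++ [e] <+: z := by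
  obtain ⟨w, rfl⟩ := h
  cases w with
  | nil => simp at hne
  | cons e w => exact ⟨e, by simp⟩

theorem dir_unique {p z : Node} {e f : ℕ} (h : p ++ [e] <+: z) (h' : p ++ [f] <+: z) : e = f := by
  have := (List.prefix_of_prefix_length_le h h' (by simp)).eq_of_length (by simp)
  simpa using this

theorem dir_lt {p z : Node} {e : ℕ} (h : p ++ [e] <+: z) (hz : z ∈ BT) : e < 2 :=
  BT_pre h hz e (by simp)

theorem branch_step {M t : ℤ} {H H' : Node → ℤ} (ht : 1 ≤ t) (htM : 4 * t ≤ M)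
    (hH : HT M H) (hH' : HT M H') {R : Node → Node → Prop} (h : Good (4*t) H H' R)
    {x p p' : Node} (hx : x ∈ BT) (hp : R p p') (hpx : p <+: x)
    (hmax : ∀ s, s <+: x → (∃ z w, R z w ∧ s <+: z) → s <+: p) :
    ∃ R' : Node → Node → Prop, Good t H H' R' ∧ (∀ z w, R z w → R' z w) ∧ ∃ y, R' x y := by
  by_cases hne : p = x
  · subst hne
    exact ⟨R, h.weaken (by omega), fun _ _ h => h, p', hp⟩
  obtain ⟨e, he⟩ := child_dir hpx hne
  have hfree : ∀ z w, R z w → ¬ p ++ [e] <+: z := by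
    intro z w hr hz
    have := (hmax _ he ⟨z, w, hr, hz⟩).length_le
    simp at this
  have he2 := dir_lt he hx
  have : ∃ f, f < 2 ∧ ∀ z w, R z w → ¬ p' ++ [f] <+: w := by
    by_contra hc
    push Not at hc
    obtain ⟨z0, w0, r0, k0⟩ := hc 0 (by omega)
    obtain ⟨z1, w1, r1, k1⟩ := hc 1 (by omega)
    have q0 := (h.le hp r0).2 ((List.prefix_append _ _).trans k0)
    have q1 := (h.le hp r1).2 ((List.prefix_append _ _).trans k1)
    have n0 : p ≠ z0 := by
      rintro rfl
      have := ((h.le r0 hp).1 List.prefix_rfl).length_le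
      have := k0.length_le
      simp at this; omega
    have n1 : p ≠ z1 := by
      rintro rfl
      have := ((h.le r1 hp).1 List.prefix_rfl).length_le
      have := k1.length_le
      simp at this; omega
    obtain ⟨e0, d0⟩ := child_dir q0 n0
    obtain ⟨e1, d1⟩ := child_dir q1 n1
    have m0 := dir_lt d0 (h.dom r0).1
    have m1 := dir_lt d1 (h.dom r1).1
    have x0 : e0 ≠ e := by rintro rfl; exact hfree _ _ r0 d0
    have x1 : e1 ≠ e := by rintro rfl; exact hfree _ _ r1 d1
    have : e0 = e1 := by omega
    subst this
    obtain ⟨m, n, hmn, hm, hn⟩ := h.meet r0 r1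
    have g1 := ((hm _).2 ⟨d0, d1⟩)
    have g2 := (h.le hp hmn).1 ((List.prefix_append _ _).trans g1)
    have n2 : p' ≠ n := by
      rintro rfl
      have := ((h.le hmn hp).2 List.prefix_rfl).length_le
      have := g1.length_le
      simp at this; omega
    obtain ⟨f, df⟩ := child_dir g2 n2
    have g3 := (hn _).1 df
    have := dir_unique g3.1 k0
    have := dir_unique g3.2 k1
    omega
  obtain ⟨f, hf2, hf⟩ := this
  have hp'f : p' ++ [f] ∈ BT := by
    intro i hi
    rw [List.mem_append] at hi
    rcases hi with hi | hi
    · exact (h.dom hp).2 i hi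
    · simp at hi; omega
  obtain ⟨y, hy, hfy, e1, e2⟩ := pick_branch ht htM hH hH' hpx hne f hp'f (h.ht hp)
  have hpy : p' <+: y := (List.prefix_append _ _).trans hfy
  have hmax' : ∀ s, s <+: y → (∃ z w, R z w ∧ s <+: w) → s <+: p' := by
    rintro s hs ⟨z, w, hr, hw⟩
    rcases List.prefix_or_prefix_of_prefix hs hfy with hc | hc
    · rcases List.prefix_or_prefix_of_prefix hc (List.prefix_append p' [f]) with hd | hd
      · exact hd
      · have l1 := hd.length_le
        have l2 := hc.length_le
        simp at l2
        by_cases hl : s.length = p'.length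
        · rw [hd.eq_of_length hl.symm]
        · have := hc.eq_of_length (by simp; omega)
          rw [this] at hw
          exact absurd hw (hf z w hr)
    · exact absurd (hc.trans hw) (hf z w hr)
  have zp : ∀ z w, R z w → (z <+: x ↔ z <+: p) := fun z w hr =>
    ⟨fun hz => hmax z hz ⟨z, w, hr, List.prefix_rfl⟩, fun hz => hz.trans hpx⟩
  have wp : ∀ z w, R z w → (w <+: y ↔ w <+: p') := fun z w hr =>
    ⟨fun hz => hmax' w hz ⟨z, w, hr, List.prefix_rfl⟩, fun hz => hz.trans hpy⟩
  have nx : ∀ z w, R z w → ¬ x <+: z := fun z w hr hz => hfree z w hr (he.trans hz)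
  have ny : ∀ z w, R z w → ¬ y <+: w := fun z w hr hz => hf z w hr (hfy.trans hz)
  refine ⟨_, (h.weaken (by omega)).extend (t := t) (by omega) hx hy e2 ?_ ?_ ?_ ?_ ?_,
    fun z w hr => Or.inl hr, y, Or.inr ⟨rfl, rfl⟩⟩
  · intro z w hr
    rw [zp z w hr, wp z w hr, h.le hr hp]
  · intro z w hr
    exact iff_of_false (nx z w hr) (ny z w hr)
  · intro z w hr hz
    have hz' := (zp z w hr).1 hz
    have := h.dist hr hp hz'
    have l1 := hz'.length_le
    have l2 := ((h.le hr hp).1 hz').length_le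
    have l3 := hpx.length_le
    have l4 := hpy.length_le
    unfold EqT at *; omega
  · intro z w hr hz
    exact absurd hz (nx z w hr)
  · intro z w hr
    obtain ⟨m, n, hmn, hm, hn⟩ := h.meet hp hr
    refine ⟨m, n, Or.inl hmn, fun s => ?_, fun s => ?_⟩
    · rw [hm s]
      exact ⟨fun hs => ⟨hs.1.trans hpx, hs.2⟩, fun hs => ⟨hmax s hs.1 ⟨z, w, hr, hs.2⟩, hs.2⟩⟩
    · rw [hn s]
      exact ⟨fun hs => ⟨hs.1.trans hpy, hs.2⟩, fun hs => ⟨hmax' s hs.1 ⟨z, w, hr, hs.2⟩, hs.2⟩⟩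

theorem full_step {M t : ℤ} {H H' : Node → ℤ} (ht : 1 ≤ t) (htM : 16 * t ≤ M)
    (hH : HT M H) (hH' : HT M H') {R : Node → Node → Prop} (h : Good (16*t) H H' R)
    {x : Node} (hx : x ∈ BT) :
    ∃ R' : Node → Node → Prop, Good t H H' R' ∧ (∀ z w, R z w → R' z w) ∧ ∃ y, R' x y := by
  obtain ⟨p, hpx, ⟨a, b, hab, hpa⟩, hmax⟩ := exists_longest x (fun s => ∃ a b, R a b ∧ s <+: a)
    ⟨[], [], h.root, List.prefix_rfl⟩
  obtain ⟨R1, g1, i1, j1, p', hp'⟩ := edge_step (t := 4*t) (by omega) (by omega) hH hH'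
    (h.weaken (by omega)) hab hpa
  obtain ⟨R2, g2, i2, y, hy⟩ := branch_step ht (by omega) hH hH' g1 hx hp' hpx (by
    rintro s hs ⟨z, w, hr, hz⟩
    obtain ⟨z', w', hr', hz'⟩ := j1 z w hr
    exact hmax s hs ⟨z', w', hr', hz.trans hz'⟩)
  exact ⟨R2, g2, fun z w hr => i2 z w (i1 z w hr), y, hy⟩

/-! ## The trees -/

def KH (AP : Type) (H : Node → ℤ) : KripkeTree AP where
  T := BT
  root := []
  rooted := ⟨by intro i hi; simp at hi, fun τ _ => List.nil_prefix,
    fun s s' hs hp => BT_pre hp hs⟩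
  nonblocking := by
    intro τ hτ
    refine ⟨0, ?_⟩
    intro i hi
    rw [List.mem_append] at hi
    rcases hi with hi | hi
    · exact hτ i hi
    · simp at hi; omega
  Lab := fun τ => {_a | H τ ≤ 0}

theorem KH_fb (AP : Type) (H : Node → ℤ) : FinBranching (KH AP H).T := by
  intro τ _
  apply (Set.Finite.image (fun n => τ ++ [n]) (Set.finite_lt_nat 2)).subset
  rintro z ⟨hz, n, rfl⟩
  exact ⟨n, hz n (by simp), rfl⟩

def qr {AP : Type} : MSOL AP → ℕ
  | .atom _ _ => 0
  | .le _ _ => 0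
  | .mem _ _ => 0
  | .not φ => qr φ
  | .and φ ψ => max (qr φ) (qr ψ)
  | .exFO _ φ => qr φ + 1
  | .exSO _ φ => qr φ

theorem ef_main {AP : Type} (D : SODom) {M : ℤ} {H H' : Node → ℤ} (hH : HT M H) (hH' : HT M H')
    (φ : MSOL AP) : φ.IsFO → ∀ (n : ℕ) (R : Node → Node → Prop) (V W : ℕ → Node)
      (V2 W2 : ℕ → Set Node), qr φ ≤ n → (16 ^ n : ℤ) ≤ M → Good (16 ^ n) H H' R →
      (∀ i, R (V i) (W i)) → (Sat D (KH AP H) V V2 φ ↔ Sat D (KH AP H') W W2 φ) := by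
  have hpos : ∀ n : ℕ, (1 : ℤ) ≤ 16 ^ n := fun n => one_le_pow₀ (by norm_num)
  induction φ with
  | atom a x =>
    intro _ n R V W V2 W2 _ _ hg hR
    have := hpos n
    have h1 := hg.dom (hR x)
    have h2 := hg.ht (hR x)
    simp only [Sat]
    refine and_congr (iff_of_true h1.1 h1.2) ?_
    show H _ ≤ 0 ↔ H' _ ≤ 0
    unfold EqT at h2
    omega
  | le x y =>
    intro _ n R V W V2 W2 _ _ hg hR
    have h1 := hg.dom (hR x)
    have h2 := hg.dom (hR y)
    exact and_congr (iff_of_true h1.1 h1.2) (and_congr (iff_of_true h2.1 h2.2)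
      (hg.le (hR x) (hR y)))
  | mem x X => intro h; exact h.elim
  | not φ ih =>
    intro h n R V W V2 W2 hq hM hg hR
    exact not_congr (ih h n R V W V2 W2 hq hM hg hR)
  | and φ ψ ih1 ih2 =>
    intro h n R V W V2 W2 hq hM hg hR
    simp only [qr, max_le_iff] at hq
    exact and_congr (ih1 h.1 n R V W V2 W2 hq.1 hM hg hR) (ih2 h.2 n R V W V2 W2 hq.2 hM hg hR)
  | exFO x φ ih =>
    intro h n R V W V2 W2 hq hM hg hR
    simp only [qr] at hq
    obtain ⟨m, rfl⟩ : ∃ m, n = m + 1 := ⟨n - 1, by omega⟩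
    have e : (16 : ℤ) ^ (m+1) = 16 * 16 ^ m := by ring
    rw [e] at hM hg
    have := hpos m
    constructor
    · rintro ⟨τ, hτ, hs⟩
      obtain ⟨R', g, i, y, hy⟩ := full_step (hpos m) hM hH hH' hg hτ
      refine ⟨y, (g.dom hy).2, (ih h m R' _ _ V2 W2 (by omega) (by omega) g ?_).1 hs⟩
      intro j
      by_cases hj : j = x
      · subst hj; simpa using hy
      · rw [Function.update_of_ne hj, Function.update_of_ne hj]; exact i _ _ (hR j)
    · rintro ⟨τ, hτ, hs⟩
      obtain ⟨R', g, i, y, hy⟩ := full_step (hpos m) hM hH' hH hg.symm hτ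
      refine ⟨y, (g.dom hy).2, (ih h m _ _ _ V2 W2 (by omega) (by omega) g.symm ?_).2 hs⟩
      intro j
      by_cases hj : j = x
      · subst hj; simpa using hy
      · rw [Function.update_of_ne hj, Function.update_of_ne hj]; exact i _ _ (hR j)
  | exSO X φ ih => intro h; exact h.elim

def H1 (M : ℤ) : Node → ℤ := fun x => M - x.length

def H2 (M : ℤ) : Node → ℤ
  | [] => M + 1
  | 0 :: l => H2 M l
  | (_ + 1) :: l => M - l.length

theorem HT1 (M : ℤ) : HT M (H1 M) where
  mono := by intro x i; simp [H1]; omega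
  step := by intro x i; simp [H1]; omega
  exact := by intro x i; simp [H1]; omega
  one := by intro x; simp [H1]; omega

theorem HT2 (M : ℤ) : HT M (H2 M) := by
  have key : ∀ x : Node, ∀ i, H2 M (x ++ [i]) ≤ H2 M x ∧ H2 M x - 1 ≤ H2 M (x ++ [i]) ∧
      (H2 M x ≤ M → H2 M (x ++ [i]) = H2 M x - 1) ∧ H2 M (x ++ [1]) ≤ M := by
    intro x i
    induction x with
    | nil => cases i <;> simp [H2]
    | cons a l ih =>
      cases a with
      | zero => simpa [H2] using ih
      | succ a => simp [H2]; omega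
  exact ⟨fun x i => (key x i).1, fun x i => (key x i).2.1, fun x i => (key x i).2.2.1,
    fun x => (key x 0).2.2.2⟩

theorem acc1 {AP : Type} (a : AP) (M : ℤ) : aAccept a (KH AP (H1 M)) := by
  intro P hP hinf _
  by_contra hc
  push Not at hc
  apply hinf
  have hb : ∀ τ ∈ P, (τ.length : ℤ) < M := by
    intro τ hτ
    have := hc τ hτ
    simp [KH, H1] at this
    exact this
  have : P ⊆ {l : List ℕ | l.length < M.toNat ∧ ∀ i ∈ l, i < 2} := by
    intro τ hτ
    exact ⟨by have := hb τ hτ; omega, hP.1.1 hτ⟩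
  refine Set.Finite.subset ?_ this
  have hf := List.finite_length_lt (Fin 2) M.toNat
  refine (hf.image (List.map Fin.val)).subset ?_
  rintro l ⟨h1, h2⟩
  refine ⟨l.pmap (fun i hi => ⟨i, hi⟩) h2, by simpa using h1, ?_⟩
  simp [List.map_pmap]

theorem nacc2 {AP : Type} (a : AP) (M : ℤ) (hM : 0 ≤ M) : ¬ aAccept a (KH AP (H2 M)) := by
  intro h
  have hz : ∀ n, H2 M (List.replicate n 0) = M + 1 := by
    intro n
    induction n with
    | zero => rfl
    | succ n ih => simpa [List.replicate_succ, H2] using ih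
  have hP : IsPathOf (KH AP (H2 M)).T (Set.range fun n => List.replicate n 0) := by
    refine ⟨⟨?_, [], ⟨0, rfl⟩, fun τ _ => List.nil_prefix, ?_⟩, ?_⟩
    · rintro _ ⟨n, rfl⟩ i hi
      rw [List.mem_replicate] at hi; omega
    · rintro s s' ⟨n, hn⟩ hp
      refine ⟨s'.length, ?_⟩
      simp only [List.nil_append] at hn ⊢
      subst hn
      symm
      rw [List.eq_replicate_iff]
      exact ⟨rfl, fun b hb => (List.mem_replicate.1 (hp.subset hb)).2⟩
    · rintro τ _ n m ⟨k, hk⟩ ⟨k', hk'⟩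
      have a1 : n ∈ List.replicate k 0 := by simp only at hk; rw [hk]; simp
      have a2 : m ∈ List.replicate k' 0 := by simp only at hk'; rw [hk']; simp
      rw [List.mem_replicate] at a1 a2
      omega
  have hI : (Set.range fun n => List.replicate n (0 : ℕ)).Infinite := by
    apply Set.infinite_range_of_injective
    intro n m hnm
    simpa using congrArg List.length hnm
  obtain ⟨τ, ⟨n, rfl⟩, h2⟩ := h _ hP hI ⟨0, rfl⟩
  · have h3 : H2 M (List.replicate n 0) ≤ 0 := h2
    rw [hz] at h3
    omega

theorem no_fo {AP : Type} (a : AP) (φ : MSOL AP) (hs : φ.IsSentence) (hφ : φ.IsFO)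
    (h : ∀ K : KripkeTree AP, FinBranching K.T → ((FOL AP).KSat K φ ↔ aAccept a K)) : False := by
  set M : ℤ := 16 ^ qr φ with hM
  have hpos : (1 : ℤ) ≤ M := one_le_pow₀ (by norm_num)
  have h1 := (h _ (KH_fb AP (H1 M))).2 (acc1 a M)
  apply nacc2 a M (by omega)
  rw [← h _ (KH_fb AP (H2 M))]
  rw [ksat_iff _ _ _ hs (fun _ => []) (fun _ => ∅)] at h1 ⊢
  refine (ef_main _ (HT1 M) (HT2 M) φ hφ (qr φ) (fun x y => x = [] ∧ y = []) _ _ _ _ le_rfl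
    le_rfl ?_ (fun _ => ⟨rfl, rfl⟩)).1 h1
  have hnil : ([] : Node) ∈ BT := by intro i hi; simp at hi
  constructor
  · rintro x y ⟨rfl, rfl⟩; exact ⟨hnil, hnil⟩
  · exact ⟨rfl, rfl⟩
  · rintro x y x' y' ⟨rfl, rfl⟩ ⟨rfl, rfl⟩
    exact ⟨[], [], ⟨rfl, rfl⟩, fun s => by simp, fun s => by simp⟩
  · rintro x y x' y' ⟨rfl, rfl⟩ ⟨rfl, rfl⟩; simp
  · rintro x y x' y' ⟨rfl, rfl⟩ ⟨rfl, rfl⟩ _; left; simp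
  · rintro x y ⟨rfl, rfl⟩
    right; left
    simp [H1, H2]; omega

theorem no_wmpl {AP : Type} (a : AP) : ¬ ∃ φ : MSOL AP, φ.IsSentence ∧
      ∀ K : KripkeTree AP, FinBranching K.T → ((WMPL AP).KSat K φ ↔ aAccept a K) := by
  rintro ⟨φ, hs, h⟩
  obtain ⟨ψ, h1, h2, h3⟩ := wmpl_leq_fo (finBrKT AP) φ hs trivial
  exact no_fo a ψ h1 h2 fun K hK => (h3 K hK).symm.trans (h K hK)

end PartB

/-- no WMPL sentence expresses `a`-acceptance, even over
finitely-branching Kripke trees; moreover WMPL ≡ FO, MPL ≡ CoWMPL, and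
WMPL < MPL, even over finitely-branching Kripke trees. -/
theorem stmt7 (AP : Type) [Fintype AP] (a : AP) :
    (¬ ∃ φ : MSOL AP, φ.IsSentence ∧
      ∀ K : KripkeTree AP, FinBranching K.T →
        ((WMPL AP).KSat K φ ↔ aAccept a K)) ∧
    MLogic.EquivExp (finBrKT AP) (WMPL AP) (FOL AP) ∧
    MLogic.EquivExp (finBrKT AP) (MPL AP) (CoWMPL AP) ∧
    MLogic.Lt (finBrKT AP) (WMPL AP) (MPL AP) := by
  refine ⟨no_wmpl a, ⟨wmpl_leq_fo _, leq_of_FO _ _ fun _ => trivial⟩,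
    ⟨mpl_leq_cowmpl _, cowmpl_leq_mpl _⟩,
    leq_trans' (wmpl_leq_fo _) (leq_of_FO _ _ fun _ => trivial), fun h => ?_⟩
  obtain ⟨φ, h1, _, h3⟩ := h (accF a) (accF_sentence a) trivial
  exact no_wmpl a ⟨φ, h1, fun K hK => (h3 K hK).symm.trans (accF_sat a K)⟩
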